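/- Let G = (V, E) be a graph, let k ≥ 0 be an integer with |V| ≥ 6(k+1), and let W ⊆ V be a (1/24)-sample for 𝓕_{k+1}. Let S ⊆ V with |S| ≤ k+1 and W ⊄ S be such that every connected component C of G ∖ S satisfies |W ∩ C| ≤ (4/5)|W ∖ S|. Then every connected component C of G ∖ S satisfies |C| ≤ (93/100)|V ∖ S|, i.e., c(S) ≤ 93/100. -/

import Mathlib

open SimpleGraph

variable {V : Type*}

/-- `u` and `w` are connected by a walk in `G` avoiding the set `S`
(i.e. they lie in the same connected component of `G ∖ S`). -/
def ReachAvoid (G : SimpleGraph V) (S : Set V) (u w : V) : Prop :=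
  ∃ p : G.Walk u w, ∀ x ∈ p.support, x ∉ S

/-- The connected component of `v` in `G ∖ S` (as a set of vertices). -/
def compAvoid (G : SimpleGraph V) (S : Set V) (v : V) : Set V :=
  {w | ReachAvoid G S v w}

/-- The set `𝒞^S` of connected components of `G ∖ S`. -/
def comps (G : SimpleGraph V) (S : Set V) : Set (Set V) :=
  {C | ∃ v, v ∉ S ∧ C = compAvoid G S v}

/-- The size of the largest connected component of `G ∖ S`. -/
noncomputable def maxComp [Fintype V] (G : SimpleGraph V) (S : Set V) : ℕ :=
  sSup {k : ℕ | ∃ C ∈ comps G S, k = C.ncard}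

/-- The centrality `c(S) = (1/|V ∖ S|) · max_{C ∈ 𝒞^S} |C|`. -/
noncomputable def cent [Fintype V] (G : SimpleGraph V) (S : Set V) : ℝ :=
  (maxComp G S : ℝ) / ((Sᶜ : Set V).ncard : ℝ)

/-- The family `𝓕_k`: all sets that are a connected component of `G ∖ S` for some `S` with
`|S| ≤ k`, or the union of all but one of the connected components of such a `G ∖ S`. -/
def family (G : SimpleGraph V) (k : ℕ) : Set (Set V) :=
  {C | ∃ S : Set V, S.ncard ≤ k ∧
    (C ∈ comps G S ∨ ∃ C₀ ∈ comps G S, C = ⋃₀ (comps G S \ {C₀}))}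

/-- `W` is a `δ`-sample for `𝓕_k`: for every `C ∈ 𝓕_k`,
`|C|/|V| − δ ≤ |W ∩ C|/|W| ≤ |C|/|V| + δ`. -/
def IsDeltaSample [Fintype V] (G : SimpleGraph V) (k : ℕ) (δ : ℝ) (W : Set V) : Prop :=
  ∀ C ∈ family G k,
    (C.ncard : ℝ) / (Fintype.card V : ℝ) - δ ≤ ((W ∩ C).ncard : ℝ) / (W.ncard : ℝ) ∧
      ((W ∩ C).ncard : ℝ) / (W.ncard : ℝ) ≤ (C.ncard : ℝ) / (Fintype.card V : ℝ) + δ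

theorem ReachAvoid.symm {G : SimpleGraph V} {S : Set V} {u w : V} (h : ReachAvoid G S u w) :
    ReachAvoid G S w u := by
  obtain ⟨p, hp⟩ := h
  exact ⟨p.reverse, fun x hx => hp x (by simpa using hx)⟩

theorem ReachAvoid.trans {G : SimpleGraph V} {S : Set V} {u v w : V} (h : ReachAvoid G S u v)
    (h' : ReachAvoid G S v w) : ReachAvoid G S u w := by
  obtain ⟨p, hp⟩ := h
  obtain ⟨q, hq⟩ := h'
  exact ⟨p.append q, fun x hx => ((p.mem_support_append_iff q).1 hx).elim (hp x) (hq x)⟩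

theorem mem_compAvoid_self {G : SimpleGraph V} {S : Set V} {v : V} (hv : v ∉ S) :
    v ∈ compAvoid G S v :=
  ⟨Walk.nil, by simpa using hv⟩

theorem compAvoid_eq_of_mem {G : SimpleGraph V} {S : Set V} {v w : V}
    (h : w ∈ compAvoid G S v) : compAvoid G S w = compAvoid G S v :=
  Set.ext fun _ => ⟨fun hx => ReachAvoid.trans h hx, fun hx => (ReachAvoid.symm h).trans hx⟩

theorem subset_compl_of_mem_comps {G : SimpleGraph V} {S C : Set V} (hC : C ∈ comps G S) :
    C ⊆ Sᶜ := by
  obtain ⟨v, -, rfl⟩ := hC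
  rintro w ⟨p, hp⟩
  exact hp w p.end_mem_support

/-- The union of all components of `G ∖ S` other than `C` is the complement of `C` in
`V ∖ S`. -/
theorem sUnion_comps_diff_singleton {G : SimpleGraph V} {S C : Set V} (hC : C ∈ comps G S) :
    ⋃₀ (comps G S \ {C}) = Sᶜ \ C := by
  ext x
  constructor
  · rintro ⟨D, ⟨hD, hne⟩, hx⟩
    refine ⟨subset_compl_of_mem_comps hD hx, fun hxC => hne ?_⟩
    obtain ⟨v, -, rfl⟩ := hC
    obtain ⟨w, -, rfl⟩ := hD
    exact (compAvoid_eq_of_mem hx).symm.trans (compAvoid_eq_of_mem hxC)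
  · rintro ⟨hxS, hxC⟩
    refine ⟨compAvoid G S x, ⟨⟨x, hxS, rfl⟩, ?_⟩, mem_compAvoid_self hxS⟩
    rintro rfl
    exact hxC (mem_compAvoid_self hxS)

theorem ncard_mem_comps_le_of_isDeltaSample [Fintype V] {G : SimpleGraph V} {k : ℕ}
    (hV : 6 * k ≤ Fintype.card V) {W : Set V} (hW : IsDeltaSample G k (1 / 24) W)
    {S : Set V} (hS : S.ncard ≤ k) (hWS : ¬ W ⊆ S) {C : Set V} (hC : C ∈ comps G S)
    (hbal : ((W ∩ C).ncard : ℝ) ≤ (4 / 5) * ((W \ S).ncard : ℝ)) :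
    (C.ncard : ℝ) ≤ (93 / 100) * ((Sᶜ : Set V).ncard : ℝ) := by
  obtain ⟨x, hxW, -⟩ := Set.not_subset.1 hWS
  have hw : (0 : ℝ) < W.ncard := by
    exact_mod_cast (Set.ncard_pos W.toFinite).2 ⟨x, hxW⟩
  have hn : (0 : ℝ) < Fintype.card V := by
    exact_mod_cast Fintype.card_pos_iff.2 ⟨x⟩
  have hCS := subset_compl_of_mem_comps hC
  have hlow := (hW C ⟨S, hS, Or.inl hC⟩).1
  have hupp := (hW (Sᶜ \ C) ⟨S, hS, Or.inr ⟨C, hC, (sUnion_comps_diff_singleton hC).symm⟩⟩).2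
  have hsplit : ((Sᶜ \ C).ncard : ℝ) + C.ncard = (Sᶜ : Set V).ncard := by
    exact_mod_cast Set.ncard_sdiff_add_ncard_of_subset hCS
  have hWsplit : ((W ∩ (Sᶜ \ C)).ncard : ℝ) + (W ∩ C).ncard = (W \ S).ncard := by
    have h := Set.ncard_sdiff_add_ncard_of_subset
      (Set.inter_subset_inter_right W hCS) (Set.toFinite _)
    have hdiff : (W ∩ Sᶜ) \ (W ∩ C) = W ∩ (Sᶜ \ C) := by
      ext y
      simp only [Set.mem_sdiff, Set.mem_inter_iff]
      tauto
    rw [hdiff, ← Set.sdiff_eq] at h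
    exact_mod_cast h
  have hcompl : (S.ncard : ℝ) + (Sᶜ : Set V).ncard = Fintype.card V := by
    have h := Set.ncard_add_ncard_compl S
    rw [Nat.card_eq_fintype_card] at h
    exact_mod_cast h
  have hSn : 6 * (S.ncard : ℝ) ≤ Fintype.card V := by
    exact_mod_cast (Nat.mul_le_mul_left 6 hS).trans hV
  have hratio : ((W ∩ C).ncard : ℝ) / W.ncard ≤ 4 * ((W ∩ (Sᶜ \ C)).ncard / W.ncard) := by
    rw [← mul_div_assoc]
    gcongr
    linarith
  have hdens : (C.ncard : ℝ) / Fintype.card V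
      ≤ (4 * (Sᶜ \ C).ncard + 5 / 24 * Fintype.card V) / Fintype.card V := by
    rw [add_div, mul_div_assoc, mul_div_cancel_right₀ _ hn.ne']
    linarith
  rw [div_le_div_iff_of_pos_right hn] at hdens
  linarith

/-- Let `|V| ≥ 6(k+1)`, let `W` be a `(1/24)`-sample for `𝓕_{k+1}`, and let
`S` with `|S| ≤ k+1`, `W ⊄ S`, be such that every connected component `C` of `G ∖ S` satisfies
`|W ∩ C| ≤ (4/5)|W ∖ S|`. Then every connected component `C` of `G ∖ S` satisfies
`|C| ≤ (93/100)|V ∖ S|`, i.e. `c(S) ≤ 93/100`. -/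
theorem balanced_separator_of_dsample [Fintype V] (G : SimpleGraph V) (k : ℕ)
    (hV : 6 * (k + 1) ≤ Fintype.card V)
    (W : Set V) (hW : IsDeltaSample G (k + 1) (1 / 24) W)
    (S : Set V) (hS : S.ncard ≤ k + 1) (hWS : ¬ W ⊆ S)
    (hbal : ∀ C ∈ comps G S, ((W ∩ C).ncard : ℝ) ≤ (4 / 5) * ((W \ S).ncard : ℝ)) :
    (∀ C ∈ comps G S, (C.ncard : ℝ) ≤ (93 / 100) * ((Sᶜ : Set V).ncard : ℝ)) ∧
      cent G S ≤ 93 / 100 := by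
  have hcomp : ∀ C ∈ comps G S, (C.ncard : ℝ) ≤ (93 / 100) * ((Sᶜ : Set V).ncard : ℝ) :=
    fun C hC => ncard_mem_comps_le_of_isDeltaSample hV hW hS hWS hC (hbal C hC)
  refine ⟨hcomp, ?_⟩
  obtain ⟨x, -, hxS⟩ := Set.not_subset.1 hWS
  have hmem : maxComp G S ∈ {k : ℕ | ∃ C ∈ comps G S, k = C.ncard} := by
    refine Nat.sSup_mem ⟨_, compAvoid G S x, ⟨x, hxS, rfl⟩, rfl⟩ ⟨Nat.card V, ?_⟩
    rintro _ ⟨C, -, rfl⟩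
    exact Set.ncard_le_card C
  obtain ⟨C, hC, hCmax⟩ := hmem
  have hpos : (0 : ℝ) < (Sᶜ : Set V).ncard := by
    exact_mod_cast (Set.ncard_pos (Set.toFinite _)).2 ⟨x, hxS⟩
  rw [cent, div_le_iff₀ hpos, hCmax]
  exact hcomp C hC
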